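/- Let X = C₀([0, ∞)) be the Banach space of continuous functions on [0, ∞) vanishing at infinity, with the supremum norm, and let λ > 0. For t ≥ 0 define the bounded linear operator T_t on X by (T_t f)(x) = e^{λ t} f(x + t). Then the semigroup (T_t)_{t≥0} is frequently hypercyclic: there exists f ∈ X such that for every non-empty open subset U of X the set { t ≥ 0 : T_t f ∈ U } has positive lower density in [0, ∞). -/

import Mathlib

open Filter Topology
open scoped Classical

/-- The lower density of a measurable set `M ⊆ ℝ₊`:
`liminf_{N→∞} μ(M ∩ [0, N]) / N` with `μ` Lebesgue measure. -/
noncomputable def lowerDensityR (M : Set ℝ) : ℝ :=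
  Filter.atTop.liminf fun N : ℕ =>
    (MeasureTheory.volume (M ∩ Set.Icc (0:ℝ) N)).toReal / (N : ℝ)

namespace FHC


lemma isCompact_le (M : ℝ) : IsCompact {x : Set.Ici (0:ℝ) | x.1 ≤ M} := by
  have h : IsCompact ((↑) ⁻¹' (Set.Icc (0:ℝ) M) : Set (Set.Ici (0:ℝ))) :=
    (isClosed_Ici.isClosedEmbedding_subtypeVal).isCompact_preimage isCompact_Icc
  refine h.of_isClosed_subset ?_ ?_
  · exact isClosed_le continuous_subtype_val continuous_const
  · intro x hx
    exact ⟨x.2, hx⟩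

lemma tendsto_iff {𝕜 : Type*} [RCLike 𝕜] (f : Set.Ici (0:ℝ) → 𝕜) :
    Tendsto f (cocompact _) (𝓝 0) ↔ ∀ ε > 0, ∃ M : ℝ, ∀ x, M < x.1 → ‖f x‖ < ε := by
  rw [Metric.tendsto_nhds]
  refine forall₂_congr fun ε hε => ?_
  simp only [dist_zero_right]
  rw [Filter.Eventually, mem_cocompact]
  constructor
  · rintro ⟨K, hK, hs⟩
    obtain ⟨M, hM⟩ := (hK.image continuous_subtype_val).bddAbove
    refine ⟨M, fun x hx => ?_⟩
    apply hs
    intro hxK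
    have := hM ⟨x, hxK, rfl⟩
    linarith
  · rintro ⟨M, hM⟩
    refine ⟨_, isCompact_le M, fun x hx => hM x ?_⟩
    simpa using hx

lemma norm_le {𝕜 : Type*} [RCLike 𝕜] (f : ZeroAtInftyContinuousMap (Set.Ici (0:ℝ)) 𝕜) {C : ℝ} (hC : 0 ≤ C) :
    ‖f‖ ≤ C ↔ ∀ x, ‖f x‖ ≤ C := by
  rw [← ZeroAtInftyContinuousMap.norm_toBCF_eq_norm, BoundedContinuousFunction.norm_le hC]
  rfl

lemma apply_le {𝕜 : Type*} [RCLike 𝕜] (f : ZeroAtInftyContinuousMap (Set.Ici (0:ℝ)) 𝕜) (x) : ‖f x‖ ≤ ‖f‖ :=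
  (norm_le f (norm_nonneg f)).1 le_rfl x

/-- right inverse -/
noncomputable def S {𝕜 : Type*} [RCLike 𝕜] (lam t : ℝ) (g : ZeroAtInftyContinuousMap (Set.Ici (0:ℝ)) 𝕜) : ZeroAtInftyContinuousMap (Set.Ici (0:ℝ)) 𝕜 where
  toFun x := Real.exp (-(lam * t)) • g (Set.projIci 0 (x.1 - t))
  continuous_toFun := by
    have : Continuous (Set.projIci (0:ℝ)) := by
      unfold Set.projIci; fun_prop
    exact continuous_const.smul (g.continuous.comp (this.comp (continuous_subtype_val.sub continuous_const)))
  zero_at_infty' := by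
    rw [tendsto_iff]
    intro ε hε
    obtain ⟨M, hM⟩ := (tendsto_iff g).1 g.zero_at_infty' (ε * Real.exp (lam * t)) (by positivity)
    refine ⟨M + t, fun x hx => ?_⟩
    rw [norm_smul, Real.norm_of_nonneg (Real.exp_pos _).le]
    have := hM (Set.projIci 0 (x.1 - t)) (by
      rw [Set.coe_projIci]
      exact lt_of_lt_of_le (by linarith) (le_max_right _ _))
    rw [Real.exp_neg, inv_mul_lt_iff₀ (Real.exp_pos _)]
    linarith

lemma S_apply {𝕜 : Type*} [RCLike 𝕜] (lam t : ℝ) (g : ZeroAtInftyContinuousMap (Set.Ici (0:ℝ)) 𝕜) (x) :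
    S lam t g x = Real.exp (-(lam * t)) • g (Set.projIci 0 (x.1 - t)) := rfl

lemma norm_S {𝕜 : Type*} [RCLike 𝕜] (lam t : ℝ) (g : ZeroAtInftyContinuousMap (Set.Ici (0:ℝ)) 𝕜) :
    ‖S lam t g‖ ≤ Real.exp (-(lam * t)) * ‖g‖ := by
  rw [norm_le _ (by positivity)]
  intro x
  rw [S_apply, norm_smul, Real.norm_of_nonneg (Real.exp_pos _).le]
  gcongr
  exact apply_le _ _

lemma exists_dense (𝕜 : Type*) [RCLike 𝕜] : ∃ G : ℕ → ZeroAtInftyContinuousMap (Set.Ici (0:ℝ)) 𝕜,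
    (∀ j, ∃ L : ℝ, ∀ x, L ≤ x.1 → G j x = 0) ∧
    ∀ U : Set (ZeroAtInftyContinuousMap (Set.Ici (0:ℝ)) 𝕜), IsOpen U → U.Nonempty → ∃ j, G j ∈ U := by
  have : LocallyCompactSpace (Set.Ici (0:ℝ)) := isClosed_Ici.locallyCompactSpace
  have : ProperSpace 𝕜 := FiniteDimensional.proper_rclike 𝕜 𝕜
  have : SecondCountableTopology 𝕜 := secondCountable_of_proper
  have : SecondCountableTopology C(Set.Ici (0:ℝ), 𝕜) := inferInstance
  let h := TopologicalSpace.denseSeq C(Set.Ici (0:ℝ), 𝕜)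
  have hd : DenseRange h := TopologicalSpace.denseRange_denseSeq _
  let c : ℕ → ℝ → ℝ := fun m x => max 0 (min 1 (m + 1 - x))
  have hc0 : ∀ m x, 0 ≤ c m x := fun m x => le_max_left _ _
  have hc1 : ∀ m x, c m x ≤ 1 := fun m x => max_le zero_le_one (min_le_left _ _)
  have hcz : ∀ (m : ℕ) x, (m + 1 : ℝ) ≤ x → c m x = 0 := fun m x hx =>
    max_eq_left ((min_le_right _ _).trans (by linarith))
  have hcone : ∀ (m : ℕ) x, x ≤ (m : ℝ) → c m x = 1 := fun m x hx => by
    simp only [c]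
    rw [min_eq_left (by linarith)]; simp
  have hcc : ∀ m, Continuous (c m) := fun m => by fun_prop
  let G' : ℕ → ℕ → ZeroAtInftyContinuousMap (Set.Ici (0:ℝ)) 𝕜 := fun n m =>
    { toFun := fun x => c m x.1 • h n x
      continuous_toFun := ((hcc m).comp continuous_subtype_val).smul (h n).continuous
      zero_at_infty' := by
        rw [tendsto_iff]
        intro ε hε
        refine ⟨m + 1, fun x hx => ?_⟩
        rw [hcz m _ hx.le]; simpa using hε }
  have hG' : ∀ n m x, G' n m x = c m x.1 • h n x := fun n m x => rfl
  refine ⟨fun j => G' j.unpair.1 j.unpair.2, fun j => ⟨(j.unpair.2 : ℝ) + 1, fun x hx => ?_⟩, ?_⟩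
  · rw [hG', hcz _ _ hx, zero_smul]
  · rintro U hU ⟨f, hf⟩
    obtain ⟨ε, hε, hball⟩ := Metric.isOpen_iff.1 hU f hf
    obtain ⟨M, hM⟩ := (tendsto_iff f).1 f.zero_at_infty' (ε / 4) (by positivity)
    obtain ⟨m, hm⟩ := exists_nat_gt M
    let V : Set C(Set.Ici (0:ℝ), 𝕜) := {g | Set.MapsTo (g - f.toContinuousMap)
      {x : Set.Ici (0:ℝ) | x.1 ≤ m + 1} (Metric.ball 0 (ε/4))}
    have hV : IsOpen V := by
      have := ContinuousMap.isOpen_setOfPred_mapsTo (isCompact_le (m+1))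
        (Metric.isOpen_ball (x := (0:𝕜)) (ε := ε/4))
      exact this.preimage (continuous_id.sub continuous_const)
    obtain ⟨n, hn⟩ := hd.exists_mem_open hV ⟨f.toContinuousMap, by
      intro x hx; simpa using hε⟩
    refine ⟨Nat.pair n m, hball ?_⟩
    simp only [Nat.unpair_pair]
    rw [Metric.mem_ball, dist_eq_norm]
    refine lt_of_le_of_lt ((norm_le _ (by positivity : 0 ≤ ε/2)).2 fun x => ?_) (by linarith : ε/2 < ε)
    have e : (G' n m - f) x = c m x.1 • (h n x - f x) - (1 - c m x.1) • f x := by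
      rw [ZeroAtInftyContinuousMap.sub_apply, hG']; module
    rw [e]
    have h1 : ‖c m x.1 • (h n x - f x)‖ ≤ ε/4 := by
      rcases le_total x.1 (m+1) with hx | hx
      · have := hn hx
        rw [Metric.mem_ball, dist_zero_right] at this
        have this : ‖h n x - f x‖ < ε/4 := this
        rw [norm_smul, Real.norm_of_nonneg (hc0 _ _)]
        calc _ ≤ 1 * ‖h n x - f x‖ := by gcongr; exact hc1 _ _
          _ ≤ _ := by linarith
      · rw [hcz _ _ hx, zero_smul, norm_zero]; positivity
    have h2 : ‖(1 - c m x.1) • f x‖ ≤ ε/4 := by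
      rcases le_or_gt x.1 m with hx | hx
      · rw [hcone _ _ hx]; simp; positivity
      · rw [norm_smul, Real.norm_of_nonneg (by linarith [hc1 m x.1])]
        have := hM x (hm.trans hx)
        calc _ ≤ 1 * ‖f x‖ := by gcongr; linarith [hc0 m x.1]
          _ ≤ _ := by linarith
    linarith [norm_sub_le (c m x.1 • (h n x - f x)) ((1 - c m x.1) • f x)]

lemma exists_gamma (𝕜 : Type*) [RCLike 𝕜] (lam : ℝ) (hlam : 0 < lam) : ∃ G : ℕ → ZeroAtInftyContinuousMap (Set.Ici (0:ℝ)) 𝕜,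
    (∀ (k : ℕ) x, (k + 1 : ℝ) ≤ x.1 → G k x = 0) ∧ (∀ k : ℕ, ‖G k‖ ≤ Real.exp (lam * (k + 1))) ∧
    ∀ U : Set (ZeroAtInftyContinuousMap (Set.Ici (0:ℝ)) 𝕜), IsOpen U → U.Nonempty → ∀ K, ∃ k ≥ K, G k ∈ U := by
  obtain ⟨G, hG, hd⟩ := exists_dense 𝕜
  let P : ℕ → ℕ → Prop := fun j k => (∀ x, (k + 1 : ℝ) ≤ x.1 → G j x = 0) ∧
    ‖G j‖ ≤ Real.exp (lam * (k + 1))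
  refine ⟨fun k => if P k.unpair.1 k then G k.unpair.1 else 0, fun k x hx => ?_, fun k => ?_, ?_⟩
  · dsimp only
    split_ifs with h
    · exact h.1 x hx
    · rfl
  · dsimp only
    split_ifs with h
    · exact h.2
    · rw [norm_zero]; positivity
  · intro U hU hne K
    obtain ⟨j, hj⟩ := hd U hU hne
    obtain ⟨L, hL⟩ := hG j
    have ev : ∀ᶠ k : ℕ in atTop, P j k ∧ K ≤ k := by
      have t1 : Tendsto (fun k : ℕ => (k:ℝ) + 1) atTop atTop :=
        tendsto_natCast_atTop_atTop.atTop_add tendsto_const_nhds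
      have t2 : Tendsto (fun k : ℕ => Real.exp (lam * (k + 1))) atTop atTop :=
        Real.tendsto_exp_atTop.comp (t1.const_mul_atTop hlam)
      filter_upwards [t1.eventually_ge_atTop L, t2.eventually_ge_atTop ‖G j‖, eventually_ge_atTop K]
        with k h1 h2 h3
      exact ⟨⟨fun x hx => hL x (h1.trans hx), h2⟩, h3⟩
    obtain ⟨a, ha⟩ := eventually_atTop.1 ev
    obtain ⟨h1, h2⟩ := ha (Nat.pair j a) (Nat.right_le_pair j a)
    refine ⟨Nat.pair j a, h2, ?_⟩
    simp only [Nat.unpair_pair]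
    rw [if_pos h1]
    exact hj

lemma density_pos (M : Set ℝ) (q : ℕ → ℝ) (δ : ℝ) (D : ℕ) (hδ : 0 < δ) (hδ1 : δ ≤ 1) (hD : 0 < D)
    (hq0 : ∀ m, 0 ≤ q m) (hq : ∀ m m', m < m' → q m + 1 ≤ q m')
    (hqD : ∀ m, q m + 1 ≤ D * (m + 1)) (hM : ∀ m, ∀ t, q m ≤ t → t < q m + δ → t ∈ M) :
    0 < lowerDensityR M := by
  have hfin : ∀ N : ℕ, MeasureTheory.volume (M ∩ Set.Icc (0:ℝ) N) ≤ ENNReal.ofReal N := fun N => by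
    refine (MeasureTheory.measure_mono Set.inter_subset_right).trans ?_
    rw [Real.volume_Icc, sub_zero]
  have hDR : (0:ℝ) < D := by exact_mod_cast hD
  have key : δ / (2 * D) ≤ lowerDensityR M := by
    unfold lowerDensityR
    refine le_liminf_of_le ?_ ?_
    · refine IsBoundedUnder.isCoboundedUnder_ge ⟨1, ?_⟩
      rw [eventually_map]
      refine Eventually.of_forall fun N => ?_
      refine div_le_one_of_le₀ ?_ (by positivity)
      exact ENNReal.toReal_le_of_le_ofReal (by positivity) (hfin N)
    · filter_upwards [eventually_ge_atTop (2 * D)] with N hN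
      have hNR : (2 * D : ℝ) ≤ N := by exact_mod_cast hN
      have hNpos : (0:ℝ) < N := by linarith
      set J := N / D with hJ
      have hJ1 : (J : ℝ) * D ≤ N := by exact_mod_cast Nat.div_mul_le_self N D
      have hJ2 : (N : ℝ) ≤ (J + 1) * D := by
        have : N < (J + 1) * D := by
          rw [add_mul, one_mul]
          exact Nat.lt_div_mul_add hD
        exact_mod_cast this.le
      rw [div_le_div_iff₀ (by positivity) hNpos]
      have hvol : δ * J ≤ (MeasureTheory.volume (M ∩ Set.Icc (0:ℝ) N)).toReal := by
        have hsub : (⋃ m ∈ Finset.range J, Set.Ico (q m) (q m + δ)) ⊆ M ∩ Set.Icc (0:ℝ) N := by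
          intro t ht
          simp only [Set.mem_iUnion, Finset.mem_range, Set.mem_Ico, exists_prop] at ht
          obtain ⟨m, hm, h1, h2⟩ := ht
          refine ⟨hM m t h1 h2, (hq0 m).trans h1, ?_⟩
          have hmJ : (m + 1 : ℝ) ≤ J := by exact_mod_cast hm
          have := hqD m
          nlinarith
        have heq : MeasureTheory.volume (⋃ m ∈ Finset.range J, Set.Ico (q m) (q m + δ))
            = ENNReal.ofReal (δ * J) := by
          rw [MeasureTheory.measure_biUnion_finset]
          · simp [Real.volume_Ico]
            rw [ENNReal.ofReal_mul hδ.le, mul_comm]; simp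
          · intro a _ b _ hab
            rw [Function.onFun, Set.disjoint_left]
            rintro t ⟨h1, h2⟩ ⟨h3, h4⟩
            rcases lt_or_gt_of_ne hab with h | h
            · linarith [hq _ _ h]
            · linarith [hq _ _ h]
          · intro _ _; exact measurableSet_Ico
        rw [← ENNReal.ofReal_le_iff_le_toReal (ne_top_of_le_ne_top ENNReal.ofReal_ne_top (hfin N)), ← heq]
        exact MeasureTheory.measure_mono hsub
      have : (N:ℝ) ≤ J * (2 * D) := by linarith
      calc δ * N ≤ δ * (J * (2 * D)) := by gcongr
        _ = δ * J * (2 * D) := by ring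
        _ ≤ _ := by gcongr
  exact lt_of_lt_of_le (by positivity) key

/-- 2-adic valuation of `n+1` -/
def v (n : ℕ) : ℕ := padicValNat 2 (n + 1)

/-- slot starts -/
def P (n : ℕ) : ℕ := ∑ i ∈ Finset.range n, 2 * (v i + 1)

/-- positions -/
def p (n : ℕ) : ℕ := P n + (v n + 1)

lemma P_succ (n : ℕ) : P (n + 1) = P n + 2 * (v n + 1) := by
  simp [P, Finset.sum_range_succ]

lemma P_fact (n : ℕ) : P n = 2 * padicValNat 2 n.factorial + 2 * n := by
  induction n with
  | zero => simp [P]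
  | succ n ih =>
    rw [P_succ, ih, Nat.factorial_succ, padicValNat.mul (by omega) (Nat.factorial_ne_zero n), v]
    ring

lemma P_le (n : ℕ) : P n ≤ 4 * n := by
  have := sub_one_mul_padicValNat_factorial (p := 2) n
  rw [P_fact]
  omega

lemma P_add (n j : ℕ) : P n + 2 * j ≤ P (n + j) := by
  induction j with
  | zero => simp
  | succ j ih => rw [← add_assoc, P_succ]; omega

lemma v_eq (k m : ℕ) : v (2 ^ k * (2 * m + 1) - 1) = k := by
  have : 0 < 2 ^ k * (2 * m + 1) := by positivity
  rw [v, Nat.sub_add_cancel this, padicValNat.mul (by positivity) (by omega), padicValNat.prime_pow,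
    padicValNat.eq_zero_of_not_dvd (by omega), add_zero]

lemma p_lt {i n : ℕ} (h : i < n) : p i + (v i + 1) + (v n + 1) ≤ p n := by
  obtain ⟨j, rfl⟩ := Nat.exists_eq_add_of_lt h
  have := P_add (i+1) j
  rw [P_succ, show i + 1 + j = i + j + 1 by ring] at this
  unfold p
  omega

lemma p_add (n i : ℕ) : p n + (v n + 1) + 2 * i + (v (i + (n+1)) + 1) ≤ p (i + (n + 1)) := by
  have := P_add (n+1) i
  rw [P_succ, show n + 1 + i = i + (n + 1) by ring] at this
  unfold p
  omega

lemma p_ge (n : ℕ) : 2 * n + (v n + 1) ≤ p n := by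
  have := P_add 0 n
  simp only [zero_add] at this
  unfold p
  omega

lemma p_le (n : ℕ) : p n + 1 ≤ 4 * (n + 1) := by
  have := P_le (n+1)
  rw [P_succ] at this
  unfold p
  omega

lemma strong_cont {𝕜 : Type*} [RCLike 𝕜] (lam : ℝ) (hlam : 0 < lam)
    (T : ℝ → ((ZeroAtInftyContinuousMap (Set.Ici (0:ℝ)) 𝕜) →L[ℝ] (ZeroAtInftyContinuousMap (Set.Ici (0:ℝ)) 𝕜)))
    (hT : ∀ t, ∀ ht : (0:ℝ) ≤ t, ∀ (f : ZeroAtInftyContinuousMap (Set.Ici (0:ℝ)) 𝕜) (x : Set.Ici (0:ℝ)),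
        T t f x = Real.exp (lam * t) • f ⟨x.1 + t, add_nonneg x.2 ht⟩) (g : ZeroAtInftyContinuousMap (Set.Ici (0:ℝ)) 𝕜) (ε : ℝ) (hε : 0 < ε) :
    ∃ δ > 0, δ ≤ 1 ∧ ∀ u, 0 ≤ u → u < δ → ‖T u g - g‖ ≤ ε := by
  have hu := Metric.uniformContinuous_iff.1 (ZeroAtInftyContinuousMap.uniformContinuous g) (ε/2) (by positivity)
  obtain ⟨d, hd, hd'⟩ := hu
  have hc : Tendsto (fun u : ℝ => (Real.exp (lam * u) - 1) * ‖g‖) (𝓝 0) (𝓝 0) := by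
    have : Continuous (fun u : ℝ => (Real.exp (lam * u) - 1) * ‖g‖) := by fun_prop
    simpa using this.tendsto 0
  obtain ⟨d2, hd2, hd2'⟩ := Metric.eventually_nhds_iff.1 (hc.eventually_le_const (by positivity : 0 < ε/2))
  refine ⟨min (min d d2) 1, by positivity, min_le_right _ _, fun u hu0 hu => ?_⟩
  have hud : u < d := hu.trans_le ((min_le_left _ _).trans (min_le_left _ _))
  have hud2 : u < d2 := hu.trans_le ((min_le_left _ _).trans (min_le_right _ _))
  rw [norm_le _ hε.le]
  intro x
  rw [ZeroAtInftyContinuousMap.sub_apply, hT u hu0]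
  set y : Set.Ici (0:ℝ) := ⟨x.1 + u, add_nonneg x.2 hu0⟩ with hy
  have e : Real.exp (lam * u) • g y - g x = (Real.exp (lam * u) - 1) • g y + (g y - g x) := by
    module
  have h1 : ‖g y - g x‖ < ε/2 := by
    rw [← dist_eq_norm]
    apply hd'
    rw [Subtype.dist_eq, Real.dist_eq, hy]
    simpa [abs_of_nonneg hu0] using hud
  have h2 : (Real.exp (lam * u) - 1) * ‖g‖ ≤ ε/2 := hd2' (by simpa [abs_of_nonneg hu0] using hud2)
  have hpos : 0 ≤ Real.exp (lam * u) - 1 := by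
    have : 1 ≤ Real.exp (lam * u) := Real.one_le_exp (by positivity)
    linarith
  rw [e]
  refine (norm_add_le _ _).trans ?_
  rw [norm_smul, Real.norm_of_nonneg hpos]
  have := mul_le_mul_of_nonneg_left (apply_le g y) hpos
  linarith

end FHC

/-- Let `X = C₀([0, ∞))` (continuous real- or complex-valued
functions on `[0, ∞)` vanishing at infinity, sup norm) and `λ > 0`.  The semigroup
`(T_t)_{t≥0}` of bounded linear operators on `X` given by `(T_t f)(x) = e^{λt} f(x + t)`
is frequently hypercyclic: there is `f ∈ X` such that for every non-empty open `U ⊆ X`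
the set `{t ≥ 0 : T_t f ∈ U}` has positive lower density in `[0, ∞)`. -/
theorem stmt15 {𝕜 : Type*} [RCLike 𝕜] (lam : ℝ) (hlam : 0 < lam)
    (T : ℝ → (ZeroAtInftyContinuousMap (Set.Ici (0:ℝ)) 𝕜 →L[ℝ]
              ZeroAtInftyContinuousMap (Set.Ici (0:ℝ)) 𝕜))
    (hT : ∀ t, ∀ ht : (0:ℝ) ≤ t,
      ∀ (f : ZeroAtInftyContinuousMap (Set.Ici (0:ℝ)) 𝕜) (x : Set.Ici (0:ℝ)),
        T t f x = Real.exp (lam * t) • f ⟨x.1 + t, add_nonneg x.2 ht⟩) :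
    ∃ f : ZeroAtInftyContinuousMap (Set.Ici (0:ℝ)) 𝕜,
      ∀ U : Set (ZeroAtInftyContinuousMap (Set.Ici (0:ℝ)) 𝕜), IsOpen U → U.Nonempty →
        0 < lowerDensityR {t : ℝ | 0 ≤ t ∧ T t f ∈ U} := by
  obtain ⟨γ, hγ0, hγn, hγd⟩ := FHC.exists_gamma 𝕜 lam hlam
  set r : ℝ := Real.exp (-(lam * 2)) with hr
  have hr0 : 0 ≤ r := (Real.exp_pos _).le
  have hr1 : r < 1 := by rw [hr, Real.exp_lt_one_iff]; linarith
  have hrpow : ∀ i : ℕ, r ^ i = Real.exp (-(lam * (2 * i))) := fun i => by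
    rw [hr, ← Real.exp_nat_mul]; congr 1; ring
  -- the pieces
  let F : ℕ → ZeroAtInftyContinuousMap (Set.Ici (0:ℝ)) 𝕜 := fun n =>
    FHC.S lam (FHC.p n) (γ (FHC.v n))
  have hFn : ∀ n, ‖F n‖ ≤ r ^ n := fun n => by
    refine (FHC.norm_S _ _ _).trans ?_
    refine (mul_le_mul_of_nonneg_left (hγn _) (Real.exp_pos _).le).trans ?_
    rw [← Real.exp_add, hrpow, Real.exp_le_exp]
    have : (2 * n + (FHC.v n + 1) : ℝ) ≤ FHC.p n := by exact_mod_cast FHC.p_ge n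
    nlinarith
  have hFs : Summable F := Summable.of_norm_bounded (summable_geometric_of_lt_one hr0 hr1) hFn
  set C : ℝ := (1 - r)⁻¹ with hC
  have hC0 : 0 < C := inv_pos.2 (by linarith)
  -- main estimate
  have main : ∀ n, ‖T (FHC.p n) (∑' i, F i) - γ (FHC.v n)‖ ≤ Real.exp (-(lam * (FHC.v n + 1))) * C := by
    intro n
    have hp0 : (0:ℝ) ≤ FHC.p n := Nat.cast_nonneg _
    rw [ContinuousLinearMap.map_tsum _ hFs,
      ← Summable.sum_add_tsum_nat_add (f := fun z => T (FHC.p n) (F z)) (n+1)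
        (hFs.map (T (FHC.p n)) (T (FHC.p n)).continuous)]
    rw [Finset.sum_range_succ, Finset.sum_eq_zero]
    · have hn : T (FHC.p n) (F n) = γ (FHC.v n) := by
        ext x
        rw [hT _ hp0, FHC.S_apply, smul_smul, ← Real.exp_add]
        simp [Set.projIci]
        congr 1
        exact Subtype.ext (max_eq_right x.2)
      rw [hn, zero_add, add_sub_cancel_left]
      refine tsum_of_norm_bounded ((hasSum_geometric_of_lt_one hr0 hr1).mul_left _) fun i => ?_
      rw [FHC.norm_le _ (by positivity)]
      intro x
      have h1 := FHC.apply_le (γ (FHC.v (i + (n+1))))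
        (Set.projIci 0 (x.1 + (FHC.p n) - FHC.p (i + (n+1))))
      rw [hT _ hp0, FHC.S_apply, smul_smul, ← Real.exp_add, norm_smul,
        Real.norm_of_nonneg (Real.exp_pos _).le]
      refine (mul_le_mul_of_nonneg_left (h1.trans (hγn _)) (Real.exp_pos _).le).trans ?_
      rw [hrpow, ← Real.exp_add, ← Real.exp_add, Real.exp_le_exp]
      have : ((FHC.p n + (FHC.v n + 1) + 2 * i + (FHC.v (i + (n+1)) + 1) : ℕ) : ℝ)
        ≤ FHC.p (i + (n + 1)) := by exact_mod_cast FHC.p_add n i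
      push_cast at this
      nlinarith
    · intro i hi
      have hin : i < n := Finset.mem_range.1 hi
      have hp : ((FHC.p i + (FHC.v i + 1) + (FHC.v n + 1) : ℕ) : ℝ) ≤ FHC.p n := by
        exact_mod_cast FHC.p_lt hin
      push_cast at hp
      ext x
      have hx : (0:ℝ) ≤ x.1 := x.2
      rw [hT _ hp0, FHC.S_apply, hγ0, smul_zero, smul_zero]
      · rfl
      · rw [Set.coe_projIci]
        refine le_trans ?_ (le_max_right _ _)
        have : (0:ℝ) ≤ FHC.v n := Nat.cast_nonneg _
        simp only
        linarith
  refine ⟨∑' i, F i, fun U hU hne => ?_⟩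
  set f := ∑' i, F i with hf
  obtain ⟨g, hg⟩ := hne
  obtain ⟨ε, hε, hball⟩ := Metric.isOpen_iff.1 hU g hg
  -- choose K
  have ht : Tendsto (fun k : ℕ => Real.exp lam * (Real.exp (-(lam * (k + 1))) * C)) atTop (𝓝 0) := by
    have t1 : Tendsto (fun k : ℕ => (k:ℝ) + 1) atTop atTop :=
      tendsto_natCast_atTop_atTop.atTop_add tendsto_const_nhds
    have t2 := (Real.tendsto_exp_neg_atTop_nhds_zero.comp (t1.const_mul_atTop hlam))
    simpa using (t2.mul_const C).const_mul (Real.exp lam)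
  obtain ⟨K, hK⟩ := eventually_atTop.1 (ht.eventually_lt_const (by positivity : 0 < ε/3))
  obtain ⟨k, hkK, hk⟩ := hγd (Metric.ball g (ε/3)) Metric.isOpen_ball
    ⟨g, Metric.mem_ball_self (by positivity)⟩ K
  obtain ⟨δ, hδ, hδ1, hδT⟩ := FHC.strong_cont lam hlam T hT (γ k) (ε/3) (by positivity)
  have hKk := hK k hkK
  rw [Metric.mem_ball, dist_eq_norm] at hk
  let N : ℕ → ℕ := fun m => 2 ^ k * (2 * m + 1) - 1
  have hN1 : ∀ m, N m + 1 = 2 ^ k * (2 * m + 1) := fun m =>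
    Nat.sub_add_cancel (Nat.succ_le_of_lt (by positivity))
  have hNv : ∀ m, FHC.v (N m) = k := fun m => FHC.v_eq k m
  have hNmono : ∀ m m', m < m' → N m < N m' := fun m m' h => by
    have : N m + 1 < N m' + 1 := by
      rw [hN1, hN1]
      exact Nat.mul_lt_mul_of_pos_left (by omega) (by positivity)
    omega
  refine FHC.density_pos _ (fun m => (FHC.p (N m) : ℝ)) δ (2 ^ k * 8) hδ hδ1 (by positivity)
    (fun m => Nat.cast_nonneg _) ?_ ?_ ?_
  · intro m m' h
    have := FHC.p_lt (hNmono m m' h)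
    have h2 : FHC.p (N m) + 1 ≤ FHC.p (N m') := by omega
    exact_mod_cast h2
  · intro m
    have := FHC.p_le (N m)
    rw [hN1] at this
    have h2 : FHC.p (N m) + 1 ≤ 2 ^ k * 8 * (m + 1) := by
      have : 0 < 2 ^ k := by positivity
      nlinarith
    exact_mod_cast h2
  · intro m t h1 h2
    have hp0 : (0:ℝ) ≤ FHC.p (N m) := Nat.cast_nonneg _
    refine ⟨hp0.trans h1, hball ?_⟩
    obtain ⟨u, rfl⟩ : ∃ u, t = FHC.p (N m) + u := ⟨t - FHC.p (N m), by ring⟩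
    have hu0 : 0 ≤ u := by linarith
    have huδ : u < δ := by linarith
    have hm := main (N m)
    rw [hNv] at hm
    set h := T (FHC.p (N m)) f - γ k with hh
    have e : T (FHC.p (N m) + u) f - g = T u h + (T u (γ k) - γ k) + (γ k - g) := by
      have : T (FHC.p (N m) + u) f = T u (T (FHC.p (N m)) f) := by
        ext x
        rw [hT _ (by linarith), hT _ hu0, hT _ hp0, smul_smul, ← Real.exp_add]
        congr 2
        · ring
        · congr 1
          simp only
          ring
      rw [this, hh, map_sub]
      abel
    have hTu : ‖T u h‖ ≤ Real.exp lam * ‖h‖ := by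
      rw [FHC.norm_le _ (by positivity)]
      intro x
      rw [hT _ hu0, norm_smul, Real.norm_of_nonneg (Real.exp_pos _).le]
      have hul : lam * u ≤ lam := by nlinarith
      gcongr
      exact FHC.apply_le _ _
    have hTu2 : ‖T u h‖ ≤ Real.exp lam * (Real.exp (-(lam * (k + 1))) * C) :=
      hTu.trans (by gcongr)
    rw [Metric.mem_ball, dist_eq_norm, e]
    have n1 := norm_add_le (T u h + (T u (γ k) - γ k)) (γ k - g)
    have n2 := norm_add_le (T u h) (T u (γ k) - γ k)
    have n3 := hδT u hu0 huδ
    linarith
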